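/- For every natural number n, the following identity of polynomials in b and q holds: Σ over pairs (P, w), where P is a Motzkin path of length n and w assigns to each up step of P starting at height h a weight in {1, −q^{h+1}}, to each level step starting at height h the weight (b−1)·q^h, and to each down step starting at height h the weight b·q^{h−1}, of the product of the assigned weights of all steps, equals Σ_{j=0}^{n} b^j · (−1)^{n−j} · [n choose j]_q, where [n choose j]_q is the Gaussian (q-)binomial coefficient. -/

import Mathlib

open Finset

inductive Step : Type
  | U | L | D
deriving DecidableEq

instance : Fintype Step where
  elems := {Step.U, Step.L, Step.D}
  complete := by intro x; cases x <;> decide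

/-- The vertical displacement of a step: up = +1, level = 0, down = -1. -/
def Step.val : Step → ℤ
  | .U => 1
  | .L => 0
  | .D => -1

/-- The partial sum of the step values of the first `i` steps;
this is the height at which step `i` starts. -/
def hsum {n : ℕ} (P : Fin n → Step) (i : ℕ) : ℤ :=
  ∑ j ∈ Finset.univ.filter (fun j : Fin n => (j : ℕ) < i), (P j).val

/-- A Motzkin path: all partial sums nonnegative and total sum 0. -/
abbrev IsMotzkin {n : ℕ} (P : Fin n → Step) : Prop :=
  (∀ i : Fin (n+1), 0 ≤ hsum P (i : ℕ)) ∧ hsum P n = 0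

/-- A Motzkin prefix of final height `k`: all partial sums nonnegative, total sum `k`. -/
abbrev IsMPrefix {n : ℕ} (P : Fin n → Step) (k : ℕ) : Prop :=
  (∀ i : Fin (n+1), 0 ≤ hsum P (i : ℕ)) ∧ hsum P n = (k : ℤ)

/-- `[h]_q = 1 + q + ... + q^(h-1)`. -/
def geo {R : Type*} [CommSemiring R] (q : R) (h : ℤ) : R :=
  ∑ i ∈ Finset.range h.toNat, q ^ i

/-- The Gaussian (q-)binomial coefficient, via the q-Pascal recurrence. -/
def qbinom {R : Type*} [CommSemiring R] (q : R) : ℕ → ℕ → R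
  | _, 0 => 1
  | 0, _+1 => 0
  | n+1, k+1 => qbinom q n k + q ^ (k+1) * qbinom q n (k+1)

/-- The binomial coefficient with integer lower argument, zero on negative arguments. -/
def ch (m : ℕ) (j : ℤ) : ℤ := if 0 ≤ j then m.choose j.toNat else 0

section aux
variable {R : Type*} [CommRing R]

lemma qb_zero (q : R) (n : ℕ) : qbinom q n 0 = 1 := by cases n <;> rfl

lemma qb_succ (q : R) (n k : ℕ) :
    qbinom q (n+1) (k+1) = qbinom q n k + q ^ (k+1) * qbinom q n (k+1) := rfl

lemma qb_gt (q : R) : ∀ n k : ℕ, n < k → qbinom q n k = 0 := by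
  intro n
  induction n with
  | zero =>
    intro k hk
    obtain ⟨k, rfl⟩ : ∃ m, k = m + 1 := ⟨k - 1, by omega⟩
    rfl
  | succ n ih =>
    intro k hk
    obtain ⟨k, rfl⟩ : ∃ m, k = m + 1 := ⟨k - 1, by omega⟩
    rw [qb_succ, ih k (by omega), ih (k+1) (by omega)]
    ring

lemma qb_absorb (q : R) : ∀ n k : ℕ,
    (1 - q ^ (k+1)) * qbinom q (n+1) (k+1) = (1 - q ^ (n+1)) * qbinom q n k := by
  intro n
  induction n with
  | zero =>
    intro k
    cases k with
    | zero => simp [qb_succ, qb_zero, qb_gt]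
    | succ k => rw [qb_gt q 1 (k+1+1) (by omega), qb_gt q 0 (k+1) (by omega)]; simp
  | succ n ih =>
    intro k
    have h1 := ih k
    rw [qb_succ q (n+1) k]
    cases k with
    | zero =>
      simp only [qb_zero] at *
      linear_combination q ^ (0+1) * h1
    | succ k =>
      have h2 := ih k
      have h3 := qb_succ q n k
      linear_combination q ^ (k+1+1) * h1 + q * h2 + (-q) * (1 - q ^ (n+1)) * h3

def hh (b q : R) (n : ℕ) : R :=
  ∑ j ∈ Finset.range (n+1), b ^ j * (-1) ^ (n - j) * qbinom q n j

def gg (b q : R) (n : ℕ) : R :=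
  ∑ j ∈ Finset.range (n+1), b ^ j * q ^ j * (-1) ^ (n - j) * qbinom q n j

lemma hh_succ (b q : R) (n : ℕ) : hh b q (n+1) = b * hh b q n - gg b q n := by
  have e : gg b q n = ∑ j ∈ Finset.range (n+1+1),
      b ^ j * q ^ j * (-(-1) ^ (n + 1 - j)) * qbinom q n j := by
    rw [Finset.sum_range_succ, qb_gt q n (n+1) (by omega), mul_zero, add_zero]
    refine Finset.sum_congr rfl fun j hj => ?_
    rw [Nat.succ_sub (by simpa [Nat.lt_succ_iff] using hj), pow_succ]
    ring
  rw [e, hh, hh, Finset.sum_range_succ', Finset.sum_range_succ' _ (n+1), Finset.mul_sum,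
    ← sub_sub, ← Finset.sum_sub_distrib]
  simp only [qb_zero, qb_succ, Nat.add_sub_add_right]
  rw [sub_eq_add_neg]
  congr 1
  · refine Finset.sum_congr rfl fun j _ => ?_
    ring
  · simp

lemma gg_succ (b q : R) (n : ℕ) :
    gg b q (n+1) = hh b q (n+1) - b * (1 - q ^ (n+1)) * hh b q n := by
  rw [gg, hh, hh, Finset.sum_range_succ', Finset.sum_range_succ' _ (n+1), Finset.mul_sum]
  rw [add_sub_right_comm, ← Finset.sum_sub_distrib]
  congr 1
  · refine Finset.sum_congr rfl fun j _ => ?_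
    have := qb_absorb q n j
    simp only [Nat.add_sub_add_right]
    linear_combination (-b ^ (j+1) * (-1) ^ (n - j)) * this
  · simp

lemma hh_rec (b q : R) (n : ℕ) :
    hh b q (n+2) = (b - 1) * hh b q (n+1) + b * (1 - q ^ (n+1)) * hh b q n := by
  rw [hh_succ, gg_succ]; ring

def FF (b q : R) (n k : ℕ) : R := (∏ i ∈ Finset.range k, (1 - q ^ (n - i))) * hh b q (n - k)

lemma hh_zero (b q : R) : hh b q 0 = 1 := by simp [hh, qb_zero]
lemma hh_one (b q : R) : hh b q 1 = b - 1 := by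
  simp [hh, Finset.sum_range_succ, qb_zero, qb_succ, qb_gt]; ring

lemma FF_gt (b q : R) (n k : ℕ) (h : n < k) : FF b q n k = 0 := by
  rw [FF, Finset.prod_eq_zero (Finset.mem_range.2 h) (by simp), zero_mul]

lemma FF_top (b q : R) (n k : ℕ) :
    FF b q (n+1) (k+1) = (1 - q ^ (n+1)) * FF b q n k := by
  rw [FF, FF, Finset.prod_range_succ']
  simp only [Nat.add_sub_add_right, Nat.sub_zero]
  ring

lemma FF_zero_rec (b q : R) (n : ℕ) :
    FF b q (n+1) 0 = (b - 1) * FF b q n 0 + b * FF b q n 1 := by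
  cases n with
  | zero => simp [FF, hh_zero, hh_one]
  | succ n => simp [FF, hh_rec]; ring

lemma FF_succ_rec (b q : R) (n k : ℕ) :
    FF b q (n+1) (k+1) = (1 - q ^ (k+1)) * FF b q n k + (b - 1) * q ^ (k+1) * FF b q n (k+1)
      + b * q ^ (k+1) * FF b q n (k+2) := by
  rw [FF_top]
  rcases lt_trichotomy n k with h | h | h
  · rw [FF_gt _ _ _ _ h, FF_gt _ _ n (k+1) (by omega), FF_gt _ _ n (k+2) (by omega)]; ring
  · subst h
    rw [FF_gt _ _ n (n+1) (by omega), FF_gt _ _ n (n+2) (by omega)]; ring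
  · obtain ⟨m, rfl⟩ : ∃ m, n = k + 1 + m := ⟨n - (k+1), by omega⟩
    have e1 : k + 1 + m - k = m + 1 := by omega
    have e2 : k + 1 + m - (k + 1) = m := by omega
    simp only [FF, Finset.prod_range_succ, e1, e2]
    cases m with
    | zero => simp [hh_zero, hh_one]; ring
    | succ m =>
      have e3 : k + 1 + (m + 1) - (k + 2) = m := by omega
      rw [e3, hh_rec]
      ring

/-- summed weight -/
def wt (b q : R) (s : Step) (h : ℤ) : R :=
  match s with
  | Step.U => 1 - q ^ (h.toNat + 1)
  | Step.L => (b - 1) * q ^ h.toNat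
  | Step.D => b * q ^ (h - 1).toNat

def pw (b q : R) {n : ℕ} (P : Fin n → Step) : R := ∏ i, wt b q (P i) (hsum P (i : ℕ))

def Pre {n : ℕ} (P : Fin n → Step) (k : ℤ) : Prop :=
  (∀ i : Fin (n+1), 0 ≤ hsum P (i : ℕ)) ∧ hsum P n = k

open Classical in
noncomputable def WW (b q : R) (n : ℕ) (k : ℤ) : R := ∑ P : Fin n → Step, if Pre P k then pw b q P else 0

lemma hsum_snoc {n : ℕ} (P : Fin n → Step) (s : Step) (i : ℕ) (hi : i ≤ n) :
    hsum (Fin.snoc P s : Fin (n+1) → Step) i = hsum P i := by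
  simp only [hsum, Finset.sum_filter, Fin.sum_univ_castSucc, Fin.snoc_castSucc, Fin.snoc_last,
    Fin.val_castSucc, Fin.val_last]
  rw [if_neg (by omega), add_zero]

lemma hsum_snoc_last {n : ℕ} (P : Fin n → Step) (s : Step) :
    hsum (Fin.snoc P s : Fin (n+1) → Step) (n+1) = hsum P n + s.val := by
  simp only [hsum, Finset.sum_filter, Fin.sum_univ_castSucc, Fin.snoc_castSucc, Fin.snoc_last,
    Fin.val_castSucc, Fin.val_last]
  rw [if_pos (by omega)]
  congr 1
  refine Finset.sum_congr rfl fun i _ => ?_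
  rw [if_pos (by omega), if_pos (by omega)]

lemma Pre_snoc {n : ℕ} (P : Fin n → Step) (s : Step) (k : ℤ) (hk : 0 ≤ k) :
    Pre (Fin.snoc P s : Fin (n+1) → Step) k ↔ Pre P (k - s.val) := by
  constructor
  · rintro ⟨h1, h2⟩
    rw [hsum_snoc_last] at h2
    refine ⟨fun i => ?_, by omega⟩
    have := h1 i.castSucc
    rwa [Fin.val_castSucc, hsum_snoc _ _ _ (by omega)] at this
  · rintro ⟨h1, h2⟩
    have h3 : hsum (Fin.snoc P s : Fin (n+1) → Step) (n+1) = k := by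
      rw [hsum_snoc_last]; omega
    refine ⟨fun i => ?_, h3⟩
    refine Fin.lastCases ?_ (fun i => ?_) i
    · rw [Fin.val_last, h3]; exact hk
    · rw [Fin.val_castSucc, hsum_snoc _ _ _ (by omega)]; exact h1 i

lemma pw_snoc (b q : R) {n : ℕ} (P : Fin n → Step) (s : Step) :
    pw b q (Fin.snoc P s : Fin (n+1) → Step) = pw b q P * wt b q s (hsum P n) := by
  rw [pw, pw, Fin.prod_univ_castSucc]
  simp only [Fin.snoc_castSucc, Fin.snoc_last, Fin.val_castSucc, Fin.val_last]
  rw [hsum_snoc _ _ _ le_rfl]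
  congr 1
  refine Finset.prod_congr rfl fun i _ => ?_
  rw [hsum_snoc _ _ _ (by omega)]

lemma sum_step (f : Step → R) : ∑ s, f s = f Step.U + f Step.L + f Step.D := by
  have : (Finset.univ : Finset Step) = {Step.U, Step.L, Step.D} := rfl
  rw [this, Finset.sum_insert (by decide), Finset.sum_insert (by decide), Finset.sum_singleton,
    add_assoc]

lemma WW_succ (b q : R) (n : ℕ) (k : ℤ) (hk : 0 ≤ k) :
    WW b q (n+1) k = WW b q n (k-1) * wt b q Step.U (k-1) + WW b q n k * wt b q Step.L k
      + WW b q n (k+1) * wt b q Step.D (k+1) := by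
  classical
  have key : ∀ s : Step, (∑ P : Fin n → Step,
      if Pre (Fin.snoc P s : Fin (n+1) → Step) k then
        pw b q (Fin.snoc P s : Fin (n+1) → Step) else 0)
      = WW b q n (k - s.val) * wt b q s (k - s.val) := by
    intro s
    rw [WW, Finset.sum_mul]
    refine Finset.sum_congr rfl fun P _ => ?_
    rw [Pre_snoc P s k hk]
    by_cases h : Pre P (k - s.val)
    · rw [if_pos h, pw_snoc, h.2, if_pos h]
    · simp [h]
  rw [WW, ← (Fin.snocEquiv (fun _ : Fin (n+1) => Step)).sum_comp, Fintype.sum_prod_type,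
    sum_step]
  have k1 := key Step.U
  have k2 := key Step.L
  have k3 := key Step.D
  simp only [Step.val, sub_zero, sub_neg_eq_add] at k1 k2 k3
  rw [← k1, ← k2, ← k3]
  rfl

lemma WW_neg (b q : R) (n : ℕ) (k : ℤ) (hk : k < 0) : WW b q n k = 0 := by
  classical
  refine Finset.sum_eq_zero fun P _ => if_neg ?_
  rintro ⟨h1, h2⟩
  have := h1 (Fin.last n)
  rw [Fin.val_last] at this
  omega

lemma WW_eq (b q : R) (n : ℕ) : ∀ k : ℕ, WW b q n k = FF b q n k := by
  induction n with
  | zero =>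
    intro k
    cases k with
    | zero => simp [WW, FF, Pre, pw, hsum, hh_zero]
    | succ k =>
      rw [FF_gt _ _ _ _ (by omega)]
      refine Finset.sum_eq_zero fun P _ => if_neg ?_
      rintro ⟨h1, h2⟩
      simp [hsum] at h2
      omega
  | succ n ih =>
    intro k
    rw [WW_succ _ _ _ _ (by omega)]
    have e : ((k:ℤ) + 1) = ((k+1 : ℕ) : ℤ) := by simp
    cases k with
    | zero =>
      rw [WW_neg _ _ _ _ (by simp), e, ih, ih, FF_zero_rec]
      simp [wt]; ring
    | succ k =>
      have e' : (((k+1:ℕ):ℤ) - 1) = (k : ℤ) := by simp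
      rw [e', e, ih, ih, ih, FF_succ_rec]
      have e'' : (((k+1+1:ℕ):ℤ) - 1).toNat = k+1 := by omega
      simp only [wt, e'', Int.toNat_natCast]
      ring

end aux

open MvPolynomial in
/-- The total weight of labelled Motzkin paths of length `n` (up steps labelled
`1` or `-q^(h+1)`, level steps weighted `(b-1)·q^h`, down steps weighted
`b·q^(h-1)`) is `∑_j b^j (-1)^(n-j) [n choose j]_q`.  Here `b = X 0`, `q = X 1`,
and the label `w` is canonically `true` off up steps. -/
theorem stmt16 (n : ℕ) :
    (∑ pw ∈ Finset.univ.filter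
        (fun pw : (Fin n → Step) × (Fin n → Bool) =>
          IsMotzkin pw.1 ∧ (∀ i, pw.1 i ≠ Step.U → pw.2 i = true)),
      ∏ i, (match pw.1 i with
            | Step.U =>
                if pw.2 i then 1
                else -(X 1 : MvPolynomial (Fin 2) ℤ) ^ ((hsum pw.1 (i : ℕ)).toNat + 1)
            | Step.L => ((X 0 : MvPolynomial (Fin 2) ℤ) - 1) *
                (X 1) ^ (hsum pw.1 (i : ℕ)).toNat
            | Step.D => (X 0 : MvPolynomial (Fin 2) ℤ) *
                (X 1) ^ (hsum pw.1 (i : ℕ) - 1).toNat))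
    = ∑ j ∈ Finset.range (n+1),
        (X 0 : MvPolynomial (Fin 2) ℤ) ^ j * (-1) ^ (n - j) *
        qbinom (X 1 : MvPolynomial (Fin 2) ℤ) n j := by
  classical
  have main := WW_eq (X 0 : MvPolynomial (Fin 2) ℤ) (X 1) n 0
  have hF : FF (X 0 : MvPolynomial (Fin 2) ℤ) (X 1) n 0 = hh (X 0) (X 1) n := by simp [FF]
  rw [hF] at main
  refine Eq.trans ?_ main
  rw [Finset.sum_filter, Fintype.sum_prod_type, WW]
  refine Finset.sum_congr rfl fun P _ => ?_
  by_cases hP : IsMotzkin P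
  · have hP' : Pre P ((0:ℕ):ℤ) := hP
    rw [if_pos hP', pw]
    have e : ∀ i, wt (X 0 : MvPolynomial (Fin 2) ℤ) (X 1) (P i) (hsum P (i:ℕ)) =
        ∑ c : Bool, if (P i ≠ Step.U → c = true) then (match P i with
            | Step.U =>
                if c then 1
                else -(X 1 : MvPolynomial (Fin 2) ℤ) ^ ((hsum P (i : ℕ)).toNat + 1)
            | Step.L => ((X 0 : MvPolynomial (Fin 2) ℤ) - 1) *
                (X 1) ^ (hsum P (i : ℕ)).toNat
            | Step.D => (X 0 : MvPolynomial (Fin 2) ℤ) *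
                (X 1) ^ (hsum P (i : ℕ) - 1).toNat) else 0 := by
      intro i
      rw [Fintype.sum_bool]
      cases P i <;> simp [wt, sub_eq_add_neg]
    simp only [e]
    rw [Finset.prod_univ_sum, Fintype.piFinset_univ]
    refine Finset.sum_congr rfl fun w _ => ?_
    by_cases hw : ∀ i, P i ≠ Step.U → w i = true
    · rw [if_pos ⟨hP, hw⟩]
      refine Finset.prod_congr rfl fun i _ => ?_
      rw [if_pos (hw i)]
    · rw [if_neg (fun h => hw h.2)]
      push Not at hw
      obtain ⟨i, h1, h2⟩ := hw
      refine (Finset.prod_eq_zero (Finset.mem_univ i) ?_).symm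
      rw [if_neg (fun h => h2 (h h1))]
  · have hP' : ¬ Pre P ((0:ℕ):ℤ) := hP
    rw [if_neg hP']
    refine Finset.sum_eq_zero fun w _ => if_neg (fun h => hP h.1)
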